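/- arXiv:2402.12871 — 5 statements merged into one kernel-verified Lean document; each statement's English description precedes it below -/
import Mathlib

section
/- Let D ⊂ ℝ^d be a bounded open set of nonzero Lebesgue measure, let f : ℝ^d → ℝ be continuously differentiable, and let V : ℝ^d → ℝ^d be continuously differentiable with compact support contained in D. Then the map t ↦ f ∘ F_t is Fréchet differentiable at t = 0 in L¹(D) with derivative ∇f^⊤V; that is, (1/|t|) ∫_D |f(x + tV(x)) − f(x) − t ∇f(x)·V(x)| dx → 0 as t → 0. -/
open MeasureTheory Filter Bornology
open scoped Topology

/-- The perturbation of identity `F_t(x) = x + t V(x)` applied to a C¹ function `f`: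
`t ↦ f ∘ F_t` is Fréchet differentiable at `t = 0` in `L¹(D)` with derivative `∇f ⊤ V`. -/
theorem stmt0 {d : ℕ} (D : Set (Fin d → ℝ)) (hDopen : IsOpen D) (hDbdd : IsBounded D)
    (hDmeas : volume D ≠ 0)
    (f : (Fin d → ℝ) → ℝ) (hf : ContDiff ℝ 1 f)
    (V : (Fin d → ℝ) → (Fin d → ℝ)) (hV : ContDiff ℝ 1 V)
    (hVcompact : HasCompactSupport V) (hVsupp : tsupport V ⊆ D) :
    Tendsto
      (fun t : ℝ =>
        (∫ x in D, |f (x + t • V x) - f x - t * fderiv ℝ f x (V x)|) / |t|)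
      (𝓝[≠] 0) (𝓝 0) := by
  obtain ⟨R, hR⟩ := hDbdd.exists_norm_le
  obtain ⟨M, hM⟩ := hVcompact.exists_bound_of_continuous hV.continuous
  have hM0 : 0 ≤ M := (norm_nonneg _).trans (hM 0)
  have hfc : Continuous (fderiv ℝ f) := hf.continuous_fderiv one_ne_zero
  have hfd : Differentiable ℝ f := hf.differentiable one_ne_zero
  obtain ⟨C, hC⟩ := (isCompact_closedBall (0 : Fin d → ℝ) (R + M)).exists_bound_of_continuousOn
    hfc.continuousOn
  have key : Tendsto (fun t : ℝ => ∫ x in D,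
      |f (x + t • V x) - f x - t * fderiv ℝ f x (V x)| / |t|) (𝓝[≠] 0)
      (𝓝 (∫ x in D, (0 : ℝ))) := by
    have hsmall : ∀ᶠ t : ℝ in 𝓝[≠] 0, |t| ≤ 1 := by
      apply eventually_nhdsWithin_of_eventually_nhds
      filter_upwards [Metric.closedBall_mem_nhds (0 : ℝ) one_pos] with t ht
      simpa using ht
    refine tendsto_integral_filter_of_dominated_convergence (fun _ => C * M + C * M) ?_ ?_ ?_ ?_
    · refine Eventually.of_forall fun t => Continuous.aestronglyMeasurable ?_
      have h1 := hf.continuous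
      have h2 := hV.continuous
      have h3 : Continuous fun x => fderiv ℝ f x (V x) := hfc.clm_apply h2
      exact Continuous.div_const (by fun_prop) _
    · filter_upwards [hsmall, self_mem_nhdsWithin] with t ht ht0
      have htp : 0 < |t| := abs_pos.mpr ht0
      filter_upwards [ae_restrict_mem hDopen.measurableSet] with x hx
      have hxR := hR x hx
      have htV : ‖t • V x‖ ≤ |t| * M := by
        rw [norm_smul, Real.norm_eq_abs]
        exact mul_le_mul_of_nonneg_left (hM x) htp.le
      have htM : |t| * M ≤ M := by nlinarith
      have hxb : x ∈ Metric.closedBall (0 : Fin d → ℝ) (R + M) := by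
        rw [mem_closedBall_zero_iff]; linarith
      have hyb : x + t • V x ∈ Metric.closedBall (0 : Fin d → ℝ) (R + M) := by
        rw [mem_closedBall_zero_iff]
        linarith [norm_add_le x (t • V x)]
      have hC0 : 0 ≤ C := (norm_nonneg _).trans (hC x hxb)
      have h1 := (convex_closedBall (0 : Fin d → ℝ) (R + M)).norm_image_sub_le_of_norm_fderiv_le
        (𝕜 := ℝ) (f := f) (fun y _ => hfd y) hC hxb hyb
      rw [add_sub_cancel_left] at h1
      have h2 : ‖t * fderiv ℝ f x (V x)‖ ≤ |t| * (C * M) := by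
        rw [norm_mul, Real.norm_eq_abs]
        refine mul_le_mul_of_nonneg_left ?_ htp.le
        exact ((fderiv ℝ f x).le_opNorm _).trans
          (mul_le_mul (hC x hxb) (hM x) (norm_nonneg _) hC0)
      have h3 := norm_sub_le (f (x + t • V x) - f x) (t * fderiv ℝ f x (V x))
      have h4 : C * ‖t • V x‖ ≤ C * (|t| * M) := mul_le_mul_of_nonneg_left htV hC0
      rw [Real.norm_eq_abs, abs_div, abs_abs, abs_abs, div_le_iff₀ htp]
      rw [Real.norm_eq_abs (_ - _ - _)] at h3
      linarith
    · exact integrableOn_const hDbdd.measure_lt_top.ne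
    · refine Eventually.of_forall fun x => ?_
      have hl : HasDerivAt (fun t : ℝ => x + t • V x) (V x) 0 := by
        simpa using ((hasDerivAt_id (0 : ℝ)).smul_const (V x)).const_add x
      have hd : HasDerivAt (fun t : ℝ => f (x + t • V x)) (fderiv ℝ f x (V x)) 0 := by
        have h0 : HasFDerivAt f (fderiv ℝ f x) (x + (0 : ℝ) • V x) := by
          simpa using (hfd x).hasFDerivAt
        exact h0.comp_hasDerivAt (0 : ℝ) hl
      have hs := (hd.tendsto_slope.sub_const (fderiv ℝ f x (V x))).abs
      rw [sub_self, abs_zero] at hs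
      refine hs.congr' ?_
      filter_upwards [self_mem_nhdsWithin] with t ht0
      have ht0' : t ≠ 0 := ht0
      rw [← abs_div, slope_def_field]
      congr 1
      simp only [zero_smul, add_zero, sub_zero]
      field_simp
  simpa only [integral_div, integral_zero] using key
end

section
/- Let Ω ⊂ ℝ^d be an open bounded set, let γ : ℝ^d × ℝ^d → [0,∞) be measurable, and let I ⊂ ℝ^d \ Ω be a measurable set. Let u, v : Ω ∪ I → ℝ be measurable with v = 0 on I, and assume that the functions (x,y) ↦ v(x)(u(x)γ(x,y) − u(y)γ(y,x)) and (x,y) ↦ (v(x) − v(y))(u(x)γ(x,y) − u(y)γ(y,x)) are Lebesgue integrable on (Ω ∪ I) × (Ω ∪ I). Then ∫_Ω v(x) ∫_{Ω ∪ I} (u(x)γ(x,y) − u(y)γ(y,x)) dy dx = (1/2) ∫_{Ω ∪ I} ∫_{Ω ∪ I} (v(x) − v(y))(u(x)γ(x,y) − u(y)γ(y,x)) dy dx. -/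
open MeasureTheory Bornology

/-- Nonlocal integration-by-parts (symmetrization) identity: for `v = 0` on the nonlocal
boundary `I` (disjoint from `Ω`), one has
`∫_Ω v(x) ∫_{Ω∪I} (u(x)γ(x,y) - u(y)γ(y,x)) dy dx
  = (1/2) ∬_{(Ω∪I)²} (v(x)-v(y))(u(x)γ(x,y) - u(y)γ(y,x)) dy dx`. -/
theorem stmt4 {d : ℕ} (Ω I : Set (Fin d → ℝ)) (hΩopen : IsOpen Ω) (hΩbdd : IsBounded Ω)
    (hImeas : MeasurableSet I) (hI : I ⊆ Ωᶜ)
    (γ : (Fin d → ℝ) → (Fin d → ℝ) → ℝ) (hγmeas : Measurable (Function.uncurry γ))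
    (hγnonneg : ∀ x y, 0 ≤ γ x y)
    (u v : (Fin d → ℝ) → ℝ) (hu : Measurable u) (hv : Measurable v)
    (hv0 : ∀ x ∈ I, v x = 0)
    (hint1 : IntegrableOn
      (fun p : (Fin d → ℝ) × (Fin d → ℝ) =>
        v p.1 * (u p.1 * γ p.1 p.2 - u p.2 * γ p.2 p.1)) ((Ω ∪ I) ×ˢ (Ω ∪ I)))
    (hint2 : IntegrableOn
      (fun p : (Fin d → ℝ) × (Fin d → ℝ) =>
        (v p.1 - v p.2) * (u p.1 * γ p.1 p.2 - u p.2 * γ p.2 p.1)) ((Ω ∪ I) ×ˢ (Ω ∪ I))) :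
    ∫ x in Ω, v x * ∫ y in Ω ∪ I, (u x * γ x y - u y * γ y x)
      = (1 / 2) * ∫ x in Ω ∪ I, ∫ y in Ω ∪ I, (v x - v y) * (u x * γ x y - u y * γ y x) := by
  set S : Set (Fin d → ℝ) := Ω ∪ I with hS
  set μ : Measure (Fin d → ℝ) := volume.restrict S with hμ
  have hprod : (volume : Measure ((Fin d → ℝ) × (Fin d → ℝ))).restrict (S ×ˢ S) = μ.prod μ := by
    rw [hμ, Measure.prod_restrict, Measure.volume_eq_prod]
  have h1 : Integrable (fun p : (Fin d → ℝ) × (Fin d → ℝ) =>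
      v p.1 * (u p.1 * γ p.1 p.2 - u p.2 * γ p.2 p.1)) (μ.prod μ) := by
    rw [← hprod]; exact hint1
  have h2 : Integrable (fun p : (Fin d → ℝ) × (Fin d → ℝ) =>
      (v p.1 - v p.2) * (u p.1 * γ p.1 p.2 - u p.2 * γ p.2 p.1)) (μ.prod μ) := by
    rw [← hprod]; exact hint2
  have hL : ∫ x in Ω, v x * ∫ y in S, (u x * γ x y - u y * γ y x)
      = ∫ x in S, v x * ∫ y in S, (u x * γ x y - u y * γ y x) := by
    symm
    apply setIntegral_eq_of_subset_of_forall_sdiff_eq_zero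
      (hΩopen.measurableSet.union hImeas) Set.subset_union_left
    rintro x ⟨hx | hx, hx'⟩
    · exact absurd hx hx'
    · simp [hv0 x hx]
  have hA : ∫ x in S, v x * ∫ y in S, (u x * γ x y - u y * γ y x)
      = ∫ p, v p.1 * (u p.1 * γ p.1 p.2 - u p.2 * γ p.2 p.1) ∂(μ.prod μ) := by
    rw [integral_prod _ h1]
    simp only [integral_const_mul]
    rfl
  have hB : ∫ x in S, ∫ y in S, (v x - v y) * (u x * γ x y - u y * γ y x)
      = ∫ p, (v p.1 - v p.2) * (u p.1 * γ p.1 p.2 - u p.2 * γ p.2 p.1) ∂(μ.prod μ) := by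
    rw [integral_prod _ h2]
  have hC : ∫ p, (v p.1 - v p.2) * (u p.1 * γ p.1 p.2 - u p.2 * γ p.2 p.1) ∂(μ.prod μ)
      = (∫ p, v p.1 * (u p.1 * γ p.1 p.2 - u p.2 * γ p.2 p.1) ∂(μ.prod μ))
        + ∫ p, v p.1 * (u p.1 * γ p.1 p.2 - u p.2 * γ p.2 p.1) ∂(μ.prod μ) := by
    have hsw := integral_prod_swap (μ := μ) (ν := μ)
      (fun p : (Fin d → ℝ) × (Fin d → ℝ) =>
        v p.1 * (u p.1 * γ p.1 p.2 - u p.2 * γ p.2 p.1))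
    nth_rewrite 2 [← hsw]
    refine Eq.trans ?_ (integral_add h1 h1.swap)
    congr 1
    funext p
    simp only [Function.comp_apply, Prod.fst_swap, Prod.snd_swap]
    ring
  rw [hL, hA, hB, hC]
  ring
end

section
/- Let Ω ⊂ ℝ^d be a bounded open set, let f : ℝ^d → ℝ be continuously differentiable, let v ∈ L¹(Ω), and let V : ℝ^d → ℝ^d be continuously differentiable with compact support contained in Ω. Then the map t ↦ ∫_Ω f(F_t(x)) v(x) ξ^t(x) dx is differentiable at t = 0 with derivative ∫_Ω (∇f(x)·V(x)) v(x) dx + ∫_Ω f(x) v(x) div V(x) dx. -/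
open MeasureTheory Bornology Matrix

/-- The Jacobian matrix of a vector field `V : ℝ^d → ℝ^d` at `x`. -/
noncomputable def jacMat {d : ℕ} (V : (Fin d → ℝ) → (Fin d → ℝ)) (x : Fin d → ℝ) :
    Matrix (Fin d) (Fin d) ℝ :=
  Matrix.of fun i j => fderiv ℝ V x (Pi.single j 1) i

/-- `ξ^t(x) = det DF_t(x) = det (I + t DV(x))`. -/
noncomputable def xi {d : ℕ} (V : (Fin d → ℝ) → (Fin d → ℝ)) (t : ℝ) (x : Fin d → ℝ) : ℝ :=
  ((1 : Matrix (Fin d) (Fin d) ℝ) + t • jacMat V x).det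

/-- The divergence `div V = tr DV`. -/
noncomputable def divg {d : ℕ} (V : (Fin d → ℝ) → (Fin d → ℝ)) (x : Fin d → ℝ) : ℝ :=
  (jacMat V x).trace

theorem aux_det_contDiff (d : ℕ) :
    ContDiff ℝ 1 (fun M : Fin d → Fin d → ℝ => (Matrix.of M).det) := by
  simp only [Matrix.det_apply, Matrix.of_apply]
  fun_prop

theorem aux_jac_cont {d : ℕ} (V : (Fin d → ℝ) → (Fin d → ℝ)) (hV : ContDiff ℝ 1 V) :
    Continuous (fun x => (fun i j => jacMat V x i j : Fin d → Fin d → ℝ)) := by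
  have h : Continuous (fderiv ℝ V) := hV.continuous_fderiv one_ne_zero
  refine continuous_pi fun i => continuous_pi fun j => ?_
  simp only [jacMat, Matrix.of_apply]
  exact (continuous_apply i).comp (h.clm_apply continuous_const)

/-- the time derivative of `xi` -/
noncomputable def dxi {d : ℕ} (V : (Fin d → ℝ) → (Fin d → ℝ)) (t : ℝ) (x : Fin d → ℝ) : ℝ :=
  fderiv ℝ (fun M : Fin d → Fin d → ℝ => (Matrix.of M).det)
    ((fun i j => (1 : Matrix (Fin d) (Fin d) ℝ) i j) + t • (fun i j => jacMat V x i j))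
    (fun i j => jacMat V x i j)

theorem aux_xi_deriv {d : ℕ} (V : (Fin d → ℝ) → (Fin d → ℝ)) (t : ℝ) (x : Fin d → ℝ) :
    HasDerivAt (fun s => xi V s x) (dxi V t x) t := by
  have h1 : HasDerivAt (fun s : ℝ => ((fun i j => (1 : Matrix (Fin d) (Fin d) ℝ) i j)
      + s • (fun i j => jacMat V x i j) : Fin d → Fin d → ℝ)) (fun i j => jacMat V x i j) t := by
    have := ((hasDerivAt_id t).smul_const
      (fun i j => jacMat V x i j : Fin d → Fin d → ℝ)).const_add
      ((fun i j => (1 : Matrix (Fin d) (Fin d) ℝ) i j) : Fin d → Fin d → ℝ)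
    simpa using this
  exact ((((aux_det_contDiff d).differentiable one_ne_zero) _).hasFDerivAt).comp_hasDerivAt t h1

theorem aux_dxi_zero {d : ℕ} (V : (Fin d → ℝ) → (Fin d → ℝ)) (x : Fin d → ℝ) :
    dxi V 0 x = divg V x := by
  have h := aux_xi_deriv V 0 x
  refine h.unique ?_
  have h2 := (Matrix.det (1 + (Polynomial.X : Polynomial ℝ) •
    (jacMat V x).map Polynomial.C)).hasDerivAt 0
  rw [Matrix.derivative_det_one_add_X_smul] at h2
  refine h2.congr_of_eventuallyEq (Filter.Eventually.of_forall fun s => ?_)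
  simp only [xi]
  rw [← Polynomial.coe_evalRingHom, RingHom.map_det]
  congr 1
  ext i j
  by_cases hij : i = j <;> (simp [hij]; exact mul_comm _ _)

theorem aux_xi_cont {d : ℕ} (V : (Fin d → ℝ) → (Fin d → ℝ)) (hV : ContDiff ℝ 1 V) :
    Continuous (fun p : ℝ × (Fin d → ℝ) => xi V p.1 p.2) := by
  have hJ := (aux_jac_cont V hV).comp (continuous_snd (X := ℝ))
  exact (aux_det_contDiff d).continuous.comp
    ((continuous_const (y := ((fun i j => (1 : Matrix (Fin d) (Fin d) ℝ) i j) :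
      Fin d → Fin d → ℝ))).add (continuous_fst.smul hJ))

theorem aux_dxi_cont {d : ℕ} (V : (Fin d → ℝ) → (Fin d → ℝ)) (hV : ContDiff ℝ 1 V) :
    Continuous (fun p : ℝ × (Fin d → ℝ) => dxi V p.1 p.2) := by
  have hJ := (aux_jac_cont V hV).comp (continuous_snd (X := ℝ))
  exact (((aux_det_contDiff d).continuous_fderiv one_ne_zero).comp
    ((continuous_const (y := ((fun i j => (1 : Matrix (Fin d) (Fin d) ℝ) i j) :
      Fin d → Fin d → ℝ))).add (continuous_fst.smul hJ))).clm_apply hJ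

theorem aux_int {d : ℕ} {Ω : Set (Fin d → ℝ)} (hm : MeasurableSet Ω) (hb : IsBounded Ω)
    {v g : (Fin d → ℝ) → ℝ} (hv : IntegrableOn v Ω) (hg : Continuous g) :
    IntegrableOn (fun x => g x * v x) Ω := by
  obtain ⟨C, hC⟩ := (hb.isCompact_closure).exists_bound_of_continuousOn hg.continuousOn
  exact Integrable.bdd_mul hv hg.aestronglyMeasurable
    ((ae_restrict_iff' hm).2 (Filter.Eventually.of_forall fun x hx => hC x (subset_closure hx)))

/-- Shape derivative of the linear functional `F_Γ(v) = ∫_Ω f v dx`: the map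
`t ↦ ∫_Ω f(F_t(x)) v(x) ξ^t(x) dx` is differentiable at `t = 0` with derivative
`∫_Ω (∇f·V) v dx + ∫_Ω f v div V dx`. -/
theorem stmt5 {d : ℕ} (Ω : Set (Fin d → ℝ)) (hΩopen : IsOpen Ω) (hΩbdd : IsBounded Ω)
    (f : (Fin d → ℝ) → ℝ) (hf : ContDiff ℝ 1 f)
    (v : (Fin d → ℝ) → ℝ) (hv : IntegrableOn v Ω)
    (V : (Fin d → ℝ) → (Fin d → ℝ)) (hV : ContDiff ℝ 1 V) (hVcompact : HasCompactSupport V)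
    (hVsupp : tsupport V ⊆ Ω) :
    HasDerivAt (fun t : ℝ => ∫ x in Ω, f (x + t • V x) * v x * xi V t x)
      ((∫ x in Ω, fderiv ℝ f x (V x) * v x) + ∫ x in Ω, f x * v x * divg V x) 0 := by
  have hm := hΩopen.measurableSet
  have hVc := hV.continuous
  have hfc := hf.continuous
  have hf' : Continuous (fderiv ℝ f) := hf.continuous_fderiv one_ne_zero
  have hxi := aux_xi_cont V hV
  have hdxi := aux_dxi_cont V hV
  let G : ℝ → (Fin d → ℝ) → ℝ := fun t x =>
    fderiv ℝ f (x + t • V x) (V x) * xi V t x + f (x + t • V x) * dxi V t x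
  have hGc : Continuous (fun p : ℝ × (Fin d → ℝ) => G p.1 p.2) := by
    have hp : Continuous (fun p : ℝ × (Fin d → ℝ) => p.2 + p.1 • V p.2) := by fun_prop
    exact (((hf'.comp hp).clm_apply (hVc.comp continuous_snd)).mul hxi).add
      ((hfc.comp hp).mul hdxi)
  have hsec : ∀ t : ℝ, Continuous (fun x => (f (x + t • V x) * xi V t x)) := fun t => by
    have hp : Continuous (fun x => x + t • V x) := by fun_prop
    exact (hfc.comp hp).mul (hxi.comp (Continuous.prodMk_right t))
  obtain ⟨C, hC⟩ := ((isCompact_closedBall (0 : ℝ) 1).prod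
    hΩbdd.isCompact_closure).exists_bound_of_continuousOn hGc.continuousOn
  have hI : ∀ t : ℝ, IntegrableOn (fun x => f (x + t • V x) * v x * xi V t x) Ω := fun t => by
    refine (aux_int hm hΩbdd hv (hsec t)).congr (Filter.Eventually.of_forall fun x => ?_)
    simp only []
    ring
  have key := (hasDerivAt_integral_of_dominated_loc_of_deriv_le
    (μ := volume.restrict Ω) (F := fun t x => f (x + t • V x) * v x * xi V t x)
    (F' := fun t x => G t x * v x) (x₀ := (0 : ℝ)) (s := Metric.ball 0 1)
    (bound := fun x => C * ‖v x‖)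
    (Metric.ball_mem_nhds 0 one_pos)
    (Filter.Eventually.of_forall fun t => (hI t).aestronglyMeasurable)
    (hI 0)
    (aux_int hm hΩbdd hv (hGc.comp (Continuous.prodMk_right 0))).aestronglyMeasurable
    ((ae_restrict_iff' hm).2 (Filter.Eventually.of_forall fun x hx t ht => by
      rw [norm_mul]
      exact mul_le_mul_of_nonneg_right
        (hC (t, x) ⟨Metric.ball_subset_closedBall ht, subset_closure hx⟩) (norm_nonneg _)))
    (hv.norm.const_mul C)
    (Filter.Eventually.of_forall fun x t _ => by
      have h1 : HasDerivAt (fun s : ℝ => x + s • V x) (V x) t := by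
        simpa using ((hasDerivAt_id t).smul_const (V x)).const_add x
      have h2 := ((hf.differentiable one_ne_zero) (x + t • V x)).hasFDerivAt.comp_hasDerivAt t h1
      have h3 := (h2.mul_const (v x)).mul (aux_xi_deriv V t x)
      refine h3.congr_deriv ?_
      simp only [G, Function.comp]
      ring)).2
  refine key.congr_deriv ?_
  have hdiv : Continuous (fun x => f x * divg V x) := by
    have := hdxi.comp (Continuous.prodMk_right (0 : ℝ))
    simp only [Function.comp_def, aux_dxi_zero] at this
    exact hfc.mul this
  have e2 : IntegrableOn (fun x => f x * v x * divg V x) Ω := by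
    refine (aux_int hm hΩbdd hv hdiv).congr (Filter.Eventually.of_forall fun x => ?_)
    simp only []
    ring
  rw [← integral_add (aux_int hm hΩbdd hv (hf'.clm_apply hVc)) e2]
  refine integral_congr_ae (Filter.Eventually.of_forall fun x => ?_)
  have hx0 : xi V 0 x = 1 := by simp [xi]
  simp only [G, zero_smul, add_zero, hx0, aux_dxi_zero]
  ring
end

section
/- Let V : ℝ^d → ℝ^d be continuously differentiable with compact support, let x ∈ ℝ^d be fixed, and let t ∈ ℝ be such that DF_s(x) = I + sDV(x) is invertible for all s in a neighborhood of t. Then the matrix-valued map s ↦ B(s)(x) is differentiable at s = t with derivative d/ds|_{s=t} B(s)(x) = tr(DV(x)(DF_t(x))^{-1}) B(t)(x) − (DF_t(x))^{-1} DV(x) B(t)(x) − ((DF_t(x))^{-1} DV(x) B(t)(x))^⊤. In particular, at t = 0 one has d/dt|_{t=0} B(t)(x) = (div V(x)) I − DV(x) − DV(x)^⊤. -/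
open MeasureTheory Bornology Matrix Filter
open scoped Topology

attribute [local instance] Matrix.normedAddCommGroup Matrix.normedSpace

/-- `B(t)(x) = ξ^t(x) (DF_t(x))⁻¹ (DF_t(x))⁻ᵀ`. -/
noncomputable def Bmat {d : ℕ} (V : (Fin d → ℝ) → (Fin d → ℝ)) (t : ℝ) (x : Fin d → ℝ) :
    Matrix (Fin d) (Fin d) ℝ :=
  xi V t x •
    (((1 : Matrix (Fin d) (Fin d) ℝ) + t • jacMat V x)⁻¹ *
      (((1 : Matrix (Fin d) (Fin d) ℝ) + t • jacMat V x)⁻¹)ᵀ)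

theorem hasDerivAt_entry {d : ℕ} {A : ℝ → Matrix (Fin d) (Fin d) ℝ}
    {A' : Matrix (Fin d) (Fin d) ℝ} {t : ℝ} :
    HasDerivAt A A' t ↔ ∀ i j, HasDerivAt (fun s => A s i j) (A' i j) t := by
  have h1 : HasDerivAt A A' t ↔ ∀ i, HasDerivAt (fun s => A s i) (A' i) t :=
    hasDerivAt_pi (𝕜 := ℝ) (ι := Fin d) (E' := fun _ => Fin d → ℝ) (φ := A) (φ' := A') (x := t)
  rw [h1]
  exact forall_congr' fun i => hasDerivAt_pi

theorem hasDerivAt_matmul {d : ℕ} {A B : ℝ → Matrix (Fin d) (Fin d) ℝ}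
    {A' B' : Matrix (Fin d) (Fin d) ℝ} {t : ℝ} (hA : HasDerivAt A A' t) (hB : HasDerivAt B B' t) :
    HasDerivAt (fun s => A s * B s) (A' * B t + A t * B') t := by
  rw [hasDerivAt_entry] at *
  intro i j
  simp only [Matrix.mul_apply, Matrix.add_apply, ← Finset.sum_add_distrib]
  exact HasDerivAt.fun_sum fun k _ => (hA i k).mul (hB k j)

theorem hasDerivAt_detAff {d : ℕ} (M : Matrix (Fin d) (Fin d) ℝ) (t : ℝ)
    (h : IsUnit ((1 : Matrix (Fin d) (Fin d) ℝ) + t • M)) :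
    HasDerivAt (fun s : ℝ => ((1 : Matrix (Fin d) (Fin d) ℝ) + s • M).det)
      ((M * ((1 : Matrix (Fin d) (Fin d) ℝ) + t • M)⁻¹).trace *
        ((1 : Matrix (Fin d) (Fin d) ℝ) + t • M).det) t := by
  set A := (1 : Matrix (Fin d) (Fin d) ℝ) + t • M with hA
  have hd := (Matrix.isUnit_iff_isUnit_det A).1 h
  set N := M * A⁻¹ with hN
  have e : ∀ s : ℝ, ((1 : Matrix (Fin d) (Fin d) ℝ) + s • M).det =
      (Polynomial.eval (s - t) (Matrix.det (1 + (Polynomial.X : Polynomial ℝ) •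
        N.map Polynomial.C))) * A.det := by
    intro s
    have : (1 : Matrix (Fin d) (Fin d) ℝ) + s • M = (1 + (s - t) • N) * A := by
      rw [add_mul, Matrix.one_mul, Matrix.smul_mul, hN, Matrix.mul_assoc, Matrix.nonsing_inv_mul _ hd, Matrix.mul_one, hA]
      module
    rw [this, Matrix.det_mul]
    congr 1
    rw [← Polynomial.coe_evalRingHom, RingHom.map_det]
    congr 1
    ext i j
    simp [Matrix.one_apply]
    split_ifs <;> simp [mul_comm]
  simp_rw [e]
  have hp := (Polynomial.hasDerivAt (Matrix.det (1 + (Polynomial.X : Polynomial ℝ) •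
        N.map Polynomial.C)) (t - t))
  have hq := HasDerivAt.comp (h := fun s : ℝ => s - t) t hp ((hasDerivAt_id t).sub_const t)
  rw [sub_self, Matrix.derivative_det_one_add_X_smul] at hq
  simpa using hq.mul_const A.det

theorem hasDerivAt_invAff {d : ℕ} (M : Matrix (Fin d) (Fin d) ℝ) (t : ℝ)
    (h : ∀ᶠ s in 𝓝 t, IsUnit ((1 : Matrix (Fin d) (Fin d) ℝ) + s • M)) :
    HasDerivAt (fun s : ℝ => ((1 : Matrix (Fin d) (Fin d) ℝ) + s • M)⁻¹)
      (-(((1 : Matrix (Fin d) (Fin d) ℝ) + t • M)⁻¹ * M *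
        ((1 : Matrix (Fin d) (Fin d) ℝ) + t • M)⁻¹)) t := by
  have hd := (Matrix.isUnit_iff_isUnit_det _).1 h.self_of_nhds
  have hc : Continuous (fun s : ℝ => (1 : Matrix (Fin d) (Fin d) ℝ) + s • M) := by fun_prop
  have hcont : ContinuousAt (fun s : ℝ => ((1 : Matrix (Fin d) (Fin d) ℝ) + s • M)⁻¹) t := by
    simp only [Matrix.inv_def, Ring.inverse_eq_inv']
    exact (hc.matrix_det.continuousAt.inv₀ hd.ne_zero).smul hc.matrix_adjugate.continuousAt
  refine hasDerivAt_iff_tendsto_slope.2 ?_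
  have hl : Tendsto (fun s : ℝ => -(((1 : Matrix (Fin d) (Fin d) ℝ) + s • M)⁻¹ * M *
        ((1 : Matrix (Fin d) (Fin d) ℝ) + t • M)⁻¹)) (𝓝[≠] t) (𝓝 (-(((1 : Matrix (Fin d) (Fin d) ℝ) + t • M)⁻¹ * M *
        ((1 : Matrix (Fin d) (Fin d) ℝ) + t • M)⁻¹))) := by
    have : ContinuousAt (fun s : ℝ => -(((1 : Matrix (Fin d) (Fin d) ℝ) + s • M)⁻¹ * M *
        ((1 : Matrix (Fin d) (Fin d) ℝ) + t • M)⁻¹)) t :=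
      ((hcont.mul continuousAt_const).mul continuousAt_const).neg
    exact this.tendsto.mono_left nhdsWithin_le_nhds
  refine hl.congr' ?_
  filter_upwards [h.filter_mono nhdsWithin_le_nhds, self_mem_nhdsWithin] with s hs hne
  have hs := (Matrix.isUnit_iff_isUnit_det _).1 hs
  have hst : s - t ≠ 0 := sub_ne_zero.2 hne
  rw [slope_def_module]
  rw [eq_inv_smul_iff₀ hst]
  set A := (1 : Matrix (Fin d) (Fin d) ℝ) + t • M with hA
  set C := (1 : Matrix (Fin d) (Fin d) ℝ) + s • M with hC
  have hM : (s - t) • M = C - A := by rw [hA, hC]; module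
  rw [smul_neg, ← Matrix.smul_mul, ← Matrix.mul_smul, hM, Matrix.mul_sub, Matrix.sub_mul,
    Matrix.nonsing_inv_mul _ hs, Matrix.mul_assoc, Matrix.mul_nonsing_inv _ hd]
  simp

/-- Differentiability of `s ↦ B(s)(x)` at `s = t` when `DF_s(x)` is invertible near `t`,
with derivative `tr(DV (DF_t)⁻¹) B(t) − (DF_t)⁻¹ DV B(t) − ((DF_t)⁻¹ DV B(t))ᵀ`;
in particular, at `t = 0` the derivative is `(div V) I − DV − DVᵀ`. -/
theorem stmt9 {d : ℕ} (V : (Fin d → ℝ) → (Fin d → ℝ)) (hV : ContDiff ℝ 1 V)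
    (hVcompact : HasCompactSupport V) (x : Fin d → ℝ) (t : ℝ)
    (hinv : ∀ᶠ s in 𝓝 t, IsUnit ((1 : Matrix (Fin d) (Fin d) ℝ) + s • jacMat V x)) :
    HasDerivAt (fun s : ℝ => Bmat V s x)
      ((jacMat V x * ((1 : Matrix (Fin d) (Fin d) ℝ) + t • jacMat V x)⁻¹).trace • Bmat V t x
        - ((1 : Matrix (Fin d) (Fin d) ℝ) + t • jacMat V x)⁻¹ * jacMat V x * Bmat V t x
        - ((((1 : Matrix (Fin d) (Fin d) ℝ) + t • jacMat V x)⁻¹ * jacMat V x * Bmat V t x)ᵀ)) t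
    ∧ (t = 0 → HasDerivAt (fun s : ℝ => Bmat V s x)
        (divg V x • (1 : Matrix (Fin d) (Fin d) ℝ) - jacMat V x - (jacMat V x)ᵀ) 0) := by
  have main : HasDerivAt (fun s : ℝ => Bmat V s x)
      ((jacMat V x * ((1 : Matrix (Fin d) (Fin d) ℝ) + t • jacMat V x)⁻¹).trace • Bmat V t x
        - ((1 : Matrix (Fin d) (Fin d) ℝ) + t • jacMat V x)⁻¹ * jacMat V x * Bmat V t x
        - ((((1 : Matrix (Fin d) (Fin d) ℝ) + t • jacMat V x)⁻¹ * jacMat V x *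
          Bmat V t x)ᵀ)) t := by
    have h1 := hasDerivAt_detAff (jacMat V x) t hinv.self_of_nhds
    have h2 := hasDerivAt_invAff (jacMat V x) t hinv
    have h3 : HasDerivAt (fun s : ℝ => (((1 : Matrix (Fin d) (Fin d) ℝ) + s • jacMat V x)⁻¹)ᵀ)
        (-(((1 : Matrix (Fin d) (Fin d) ℝ) + t • jacMat V x)⁻¹ * jacMat V x *
          ((1 : Matrix (Fin d) (Fin d) ℝ) + t • jacMat V x)⁻¹))ᵀ t := by
      rw [hasDerivAt_entry] at h2 ⊢
      exact fun i j => h2 j i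
    have h4 := h1.fun_smul (hasDerivAt_matmul h2 h3)
    unfold Bmat xi
    refine HasDerivAt.congr_deriv h4 ?_
    simp only [Matrix.transpose_mul, Matrix.transpose_smul, Matrix.transpose_neg,
      Matrix.transpose_transpose, Matrix.mul_smul, Matrix.mul_assoc, Matrix.neg_mul,
      Matrix.mul_neg]
    module
  refine ⟨main, ?_⟩
  rintro rfl
  convert main using 1
  simp [Bmat, xi, divg]
end

section
/- Let H be a real normed vector space, T > 0, and G : [0,T] × H × H → ℝ. Let (u^t)_{t∈[0,T]} and (v^t)_{t∈[0,T]} be families in H with u⁰ = u^{t=0} and v⁰ = v^{t=0}, and suppose: (i) for every t ∈ [0,T] the value G(t, u^t, v) is independent of v, i.e. G(t, u^t, v) = G(t, u^t, w) for all v, w ∈ H; (ii) there is a map d_uG such that for all t ∈ [0,T], u, v, ũ ∈ H the function r ↦ G(t, u + rũ, v) has derivative d_uG(t, u, v)[ũ] at r = 0; (iii) (H0) for every (t,v) ∈ [0,T] × H the map s ↦ G(t, su^t + (1−s)u⁰, v) is absolutely continuous on [0,1] and s ↦ d_uG(t, su^t + (1−s)u⁰, v)[ũ] is integrable on (0,1)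 for every ũ ∈ H; (iv) for every t ∈ [0,T], v^t satisfies the averaged adjoint equation ∫₀¹ d_uG(t, su^t + (1−s)u⁰, v^t)[ũ] ds = 0 for all ũ ∈ H; (v) the partial derivative ∂_t G(0, u⁰, v⁰) := lim_{t↘0}(G(t,u⁰,v⁰) − G(0,u⁰,v⁰))/t exists; (vi) (H1) lim_{t↘0} (G(t, u⁰, v^t) − G(0, u⁰, v^t))/t = ∂_t G(0, u⁰, v⁰). Then for every v ∈ H, lim_{t↘0} (G(t, u^t, v) − G(0, u⁰, v))/t = ∂_t G(0, u⁰, v⁰). -/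
open MeasureTheory Filter
open scoped Topology

/-- A real function is absolutely continuous on `[0,1]`: for every `ε > 0` there is `δ > 0`
such that for every finite family of pairwise disjoint subintervals of `[0,1]` of total
length `< δ`, the sum of the variations of `φ` over these intervals is `< ε`. -/
def AbsolutelyContinuousOnUnitInterval (φ : ℝ → ℝ) : Prop :=
  ∀ ε > (0 : ℝ), ∃ δ > (0 : ℝ), ∀ (n : ℕ) (a b : Fin n → ℝ),
    (∀ i, a i ∈ Set.Icc (0 : ℝ) 1 ∧ b i ∈ Set.Icc (0 : ℝ) 1 ∧ a i ≤ b i) →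
    (Pairwise fun i j => Disjoint (Set.Ioo (a i) (b i)) (Set.Ioo (a j) (b j))) →
    (∑ i, (b i - a i)) < δ → (∑ i, |φ (b i) - φ (a i)|) < ε

/-- The abstract averaged adjoint method: under the state-equation property (i), existence
of the Gateaux derivative `d_uG` (ii), assumption (H0) (iii), the averaged adjoint equation
(iv), existence of `∂_t G(0,u⁰,v⁰)` (v) and assumption (H1) (vi), one has
`lim_{t↘0} (G(t,u^t,v) − G(0,u⁰,v))/t = ∂_t G(0,u⁰,v⁰)` for every `v`. -/
theorem stmt14 {H : Type*} [NormedAddCommGroup H] [NormedSpace ℝ H]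
    (T : ℝ) (hT : 0 < T) (G : ℝ → H → H → ℝ) (u v : ℝ → H)
    (duG : ℝ → H → H → H → ℝ)
    -- (i) the state solution property: `G(t, u^t, ·)` does not depend on its third argument
    (hstate : ∀ t ∈ Set.Icc 0 T, ∀ w w' : H, G t (u t) w = G t (u t) w')
    -- (ii) `duG` is the Gateaux derivative of `G` in its second argument
    (hgateaux : ∀ t ∈ Set.Icc 0 T, ∀ p w utilde : H,
      HasDerivAt (fun r : ℝ => G t (p + r • utilde) w) (duG t p w utilde) 0)
    -- (iii) assumption (H0)
    (hH0a : ∀ t ∈ Set.Icc 0 T, ∀ w : H,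
      AbsolutelyContinuousOnUnitInterval (fun s => G t (s • u t + (1 - s) • u 0) w))
    (hH0b : ∀ t ∈ Set.Icc 0 T, ∀ w utilde : H,
      IntervalIntegrable (fun s => duG t (s • u t + (1 - s) • u 0) w utilde) volume 0 1)
    -- (iv) `v^t` solves the averaged adjoint equation
    (hAAE : ∀ t ∈ Set.Icc 0 T, ∀ utilde : H,
      ∫ s in (0 : ℝ)..1, duG t (s • u t + (1 - s) • u 0) (v t) utilde = 0)
    -- (v) the partial derivative `∂_t G(0, u⁰, v⁰)` exists
    (dG : ℝ)
    (hdG : Tendsto (fun t : ℝ => (G t (u 0) (v 0) - G 0 (u 0) (v 0)) / t) (𝓝[>] 0) (𝓝 dG))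
    -- (vi) assumption (H1)
    (hH1 : Tendsto (fun t : ℝ => (G t (u 0) (v t) - G 0 (u 0) (v t)) / t) (𝓝[>] 0) (𝓝 dG)) :
    ∀ w : H,
      Tendsto (fun t : ℝ => (G t (u t) w - G 0 (u 0) w) / t) (𝓝[>] 0) (𝓝 dG) := by
  intro w
  refine hH1.congr' ?_
  have hmem : Set.Ioc (0 : ℝ) T ∈ 𝓝[>] (0 : ℝ) := Ioc_mem_nhdsGT hT
  filter_upwards [hmem] with t ht
  have htI : t ∈ Set.Icc 0 T := ⟨ht.1.le, ht.2⟩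
  have h0I : (0 : ℝ) ∈ Set.Icc 0 T := ⟨le_rfl, hT.le⟩
  have hd : ∀ s : ℝ, HasDerivAt (fun s => G t (s • u t + (1 - s) • u 0) (v t))
      (duG t (s • u t + (1 - s) • u 0) (v t) (u t - u 0)) s := by
    intro s
    have h := hgateaux t htI (s • u t + (1 - s) • u 0) (v t) (u t - u 0)
    have h2 : HasDerivAt (fun r : ℝ => r - s) 1 s := (hasDerivAt_id s).sub_const s
    have h3 := HasDerivAt.comp_of_eq (h := fun r : ℝ => r - s) s h h2 (sub_self s).symm
    rw [mul_one] at h3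
    refine h3.congr_of_eventuallyEq (Eventually.of_forall fun r => ?_)
    simp only [Function.comp]
    congr 1
    module
  have hint := intervalIntegral.integral_eq_sub_of_hasDerivAt (fun s _ => hd s)
    (hH0b t htI (v t) (u t - u 0))
  rw [hAAE t htI] at hint
  simp only [one_smul, sub_self, zero_smul, add_zero, sub_zero, zero_add] at hint
  have e1 := hstate t htI w (v t)
  have e2 := hstate 0 h0I w (v t)
  rw [e1, e2]
  congr 1
  linarith
end
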